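/- Let U and V be independent standard Gaussian random variables, let m, n be nonnegative integers with m > n, and let r be a positive integer. Then for every γ ∈ (0, 1), E[U^{2m} V^{2n} (γU² − (1−γ)V²)^{2r}] > 2^{m+n+2r} · (1/2)_m · (1/2)_{n+r} · (1/2)_r. -/

import Mathlib

open MeasureTheory ProbabilityTheory

/-- The rising factorial `(α)_k = α (α+1) ⋯ (α+k-1)`, with `(α)_0 = 1`. -/
def risingFactorial (α : ℝ) (k : ℕ) : ℝ := ∏ j ∈ Finset.range k, (α + j)

lemma risingFactorial_zero (α : ℝ) : risingFactorial α 0 = 1 := by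
  simp [risingFactorial]

lemma risingFactorial_succ (α : ℝ) (k : ℕ) :
    risingFactorial α (k + 1) = risingFactorial α k * (α + k) := by
  simp [risingFactorial, Finset.prod_range_succ]

lemma risingFactorial_pos {α : ℝ} (hα : 0 < α) (k : ℕ) : 0 < risingFactorial α k :=
  Finset.prod_pos fun _ _ => by positivity

/-- The mixed moment `E[X ^ i * Y ^ j * (γ X - (1 - γ) Y) ^ N]` of two independent
Gamma variables `X, Y` of shape `1/2`, given by its recursion in `N`. -/
noncomputable def mixedMoment (γ : ℝ) : ℕ → ℕ → ℕ → ℝ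
  | i, j, 0 => risingFactorial (1 / 2) i * risingFactorial (1 / 2) j
  | i, j, N + 1 => γ * mixedMoment γ (i + 1) j N - (1 - γ) * mixedMoment γ i (j + 1) N

lemma mixedMoment_zero (γ : ℝ) (i j : ℕ) :
    mixedMoment γ i j 0 = risingFactorial (1 / 2) i * risingFactorial (1 / 2) j := rfl

lemma mixedMoment_succ (γ : ℝ) (i j N : ℕ) :
    mixedMoment γ i j (N + 1) =
      γ * mixedMoment γ (i + 1) j N - (1 - γ) * mixedMoment γ i (j + 1) N := rfl

lemma mixedMoment_left_zero (γ : ℝ) (i j : ℕ) :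
    mixedMoment γ (i + 1) j 0 = (1 / 2 + i) * mixedMoment γ i j 0 := by
  simp only [mixedMoment_zero, risingFactorial_succ]
  ring

lemma mixedMoment_right_zero (γ : ℝ) (i j : ℕ) :
    mixedMoment γ i (j + 1) 0 = (1 / 2 + j) * mixedMoment γ i j 0 := by
  simp only [mixedMoment_zero, risingFactorial_succ]
  ring

/-- Integration by parts in the first variable. -/
lemma mixedMoment_left_succ (γ : ℝ) (N : ℕ) : ∀ i j : ℕ,
    mixedMoment γ (i + 1) j (N + 1) =
      (1 / 2 + i) * mixedMoment γ i j (N + 1) + (N + 1) * γ * mixedMoment γ (i + 1) j N := by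
  induction N with
  | zero =>
    intro i j
    simp only [zero_add, mixedMoment_succ γ _ _ 0, mixedMoment_left_zero]
    push_cast
    ring
  | succ N ih =>
    intro i j
    rw [mixedMoment_succ γ (i + 1) j (N + 1), ih (i + 1) j, ih i (j + 1),
      mixedMoment_succ γ i j (N + 1)]
    have h := mixedMoment_succ γ (i + 1) j N
    push_cast
    linear_combination (-(N + 1 : ℝ) * γ) * h

/-- Integration by parts in the second variable. -/
lemma mixedMoment_right_succ (γ : ℝ) (N : ℕ) : ∀ i j : ℕ,
    mixedMoment γ i (j + 1) (N + 1) =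
      (1 / 2 + j) * mixedMoment γ i j (N + 1) -
        (N + 1) * (1 - γ) * mixedMoment γ i (j + 1) N := by
  induction N with
  | zero =>
    intro i j
    simp only [zero_add, mixedMoment_succ γ _ _ 0, mixedMoment_right_zero]
    push_cast
    ring
  | succ N ih =>
    intro i j
    rw [mixedMoment_succ γ i (j + 1) (N + 1), ih (i + 1) j, ih i (j + 1),
      mixedMoment_succ γ i j (N + 1)]
    have h := mixedMoment_succ γ i (j + 1) N
    push_cast
    linear_combination ((N + 1 : ℝ) * (1 - γ)) * h

lemma mixedMoment_left_add_right (γ : ℝ) (i j N : ℕ) :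
    mixedMoment γ (i + 1) j N + mixedMoment γ i (j + 1) N =
      (1 + i + j + N) * mixedMoment γ i j N := by
  cases N with
  | zero =>
    rw [mixedMoment_left_zero, mixedMoment_right_zero]
    push_cast
    ring
  | succ N =>
    rw [mixedMoment_left_succ, mixedMoment_right_succ]
    have h := mixedMoment_succ γ i j N
    push_cast
    linear_combination (-(N + 1 : ℝ)) * h

lemma hasDerivAt_mixedMoment_of_hasDerivAt {γ A B : ℝ} {i j N : ℕ}
    (hA : HasDerivAt (fun x => mixedMoment x (i + 1) j N) A γ)
    (hB : HasDerivAt (fun x => mixedMoment x i (j + 1) N) B γ) :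
    HasDerivAt (fun x => mixedMoment x i j (N + 1))
      ((1 + i + j + N) * mixedMoment γ i j N + (γ * A - (1 - γ) * B)) γ := by
  have h := ((hasDerivAt_id γ).mul hA).sub (((hasDerivAt_id γ).const_sub 1).mul hB)
  rw [← mixedMoment_left_add_right]
  convert! h using 1
  simp only [id]
  ring

lemma hasDerivAt_mixedMoment_succ (γ : ℝ) (N : ℕ) : ∀ i j : ℕ,
    HasDerivAt (fun x => mixedMoment x i j (N + 1))
      ((N + 1) * (1 + i + j + N) * mixedMoment γ i j N) γ := by
  induction N with
  | zero =>
    intro i j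
    convert hasDerivAt_mixedMoment_of_hasDerivAt (γ := γ) (i := i) (j := j) (N := 0)
      (hasDerivAt_const _ _) (hasDerivAt_const _ _) using 1
    push_cast
    ring
  | succ N ih =>
    intro i j
    convert hasDerivAt_mixedMoment_of_hasDerivAt (ih (i + 1) j) (ih i (j + 1)) using 1
    have h := mixedMoment_succ γ i j N
    push_cast
    linear_combination ((N + 1 : ℝ) * (2 + i + j + N)) * h

lemma continuous_mixedMoment (i j N : ℕ) : Continuous fun x => mixedMoment x i j N := by
  cases N with
  | zero => exact continuous_const
  | succ N =>
    exact continuous_iff_continuousAt.2 fun x =>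
      (hasDerivAt_mixedMoment_succ x N i j).continuousAt

lemma mixedMoment_half_one (n : ℕ) : mixedMoment (1 / 2) n n 1 = 0 := by
  rw [mixedMoment_succ _ n n 0, mixedMoment_left_zero, mixedMoment_right_zero]
  ring

lemma mixedMoment_half_add_two (n N : ℕ) :
    mixedMoment (1 / 2) n n (N + 2) =
      (N + 1) / 4 * (1 + 2 * n + N) * mixedMoment (1 / 2) n n N := by
  rw [mixedMoment_succ _ n n (N + 1), mixedMoment_left_succ, mixedMoment_right_succ]
  have h := mixedMoment_left_add_right (1 / 2) n n N
  linear_combination ((N + 1 : ℝ) / 4) * h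

lemma mixedMoment_half_odd (n r : ℕ) : mixedMoment (1 / 2) n n (2 * r + 1) = 0 := by
  induction r with
  | zero => exact mixedMoment_half_one n
  | succ r ih =>
    rw [show 2 * (r + 1) + 1 = (2 * r + 1) + 2 by ring, mixedMoment_half_add_two, ih, mul_zero]

lemma mixedMoment_half_even (n r : ℕ) :
    mixedMoment (1 / 2) n n (2 * r) =
      risingFactorial (1 / 2) n * risingFactorial (1 / 2) (n + r) *
        risingFactorial (1 / 2) r := by
  induction r with
  | zero => simp [mixedMoment_zero, risingFactorial_zero]
  | succ r ih =>
    rw [show 2 * (r + 1) = 2 * r + 2 by ring, mixedMoment_half_add_two, ih, ← add_assoc,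
      risingFactorial_succ, risingFactorial_succ]
    push_cast
    ring

lemma mixedMoment_half_even_pos (n r : ℕ) : 0 < mixedMoment (1 / 2) n n (2 * r) := by
  rw [mixedMoment_half_even]
  have := risingFactorial_pos (α := 1 / 2) (by norm_num)
  exact mul_pos (mul_pos (this _) (this _)) (this _)

lemma mixedMoment_half_nonneg (n N : ℕ) : 0 ≤ mixedMoment (1 / 2) n n N := by
  rcases Nat.even_or_odd' N with ⟨r, rfl | rfl⟩
  · exact (mixedMoment_half_even_pos n r).le
  · exact (mixedMoment_half_odd n r).ge

lemma mixedMoment_half_left_pos (n N : ℕ) : 0 < mixedMoment (1 / 2) (n + 1) n N := by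
  induction N with
  | zero =>
    rw [mixedMoment_zero]
    exact mul_pos (risingFactorial_pos (by norm_num) _) (risingFactorial_pos (by norm_num) _)
  | succ N ih =>
    rw [mixedMoment_left_succ]
    have := mixedMoment_half_nonneg n (N + 1)
    positivity

lemma mixedMoment_one_pos (N : ℕ) : ∀ i j : ℕ, 0 < mixedMoment 1 i j N := by
  induction N with
  | zero =>
    intro i j
    rw [mixedMoment_zero]
    exact mul_pos (risingFactorial_pos (by norm_num) _) (risingFactorial_pos (by norm_num) _)
  | succ N ih =>
    intro i j
    rw [mixedMoment_succ]
    simpa using ih (i + 1) j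

lemma mixedMoment_half_lt_of_pos (n r : ℕ) (hpos : ∀ x, 0 < mixedMoment x n n (2 * r))
    {γ : ℝ} (hγ : γ ≠ 1 / 2) :
    mixedMoment (1 / 2) n n (2 * r + 2) < mixedMoment γ n n (2 * r + 2) := by
  have hmono : StrictMono fun x => mixedMoment x n n (2 * r + 1) := by
    refine strictMono_of_deriv_pos fun x => ?_
    rw [(hasDerivAt_mixedMoment_succ x (2 * r) n n).deriv]
    exact mul_pos (by positivity) (hpos x)
  have hhalf := mixedMoment_half_odd n r
  have hcont := (continuous_mixedMoment n n (2 * r + 2))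
  rcases lt_or_gt_of_ne hγ with hlt | hgt
  · refine strictAntiOn_of_deriv_neg (convex_Iic (1 / 2 : ℝ)) hcont.continuousOn
      (fun x hx => ?_) (Set.mem_Iic.2 hlt.le) Set.self_mem_Iic hlt
    rw [interior_Iic] at hx
    rw [(hasDerivAt_mixedMoment_succ x (2 * r + 1) n n).deriv]
    exact mul_neg_of_pos_of_neg (by positivity) (hhalf ▸ hmono hx)
  · refine strictMonoOn_of_deriv_pos (convex_Ici (1 / 2 : ℝ)) hcont.continuousOn
      (fun x hx => ?_) Set.self_mem_Ici (Set.mem_Ici.2 hgt.le) hgt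
    rw [interior_Ici] at hx
    rw [(hasDerivAt_mixedMoment_succ x (2 * r + 1) n n).deriv]
    exact mul_pos (by positivity) (hhalf ▸ hmono hx)

/-- In the symmetric case the even moments are minimised exactly at `γ = 1/2`. -/
lemma mixedMoment_half_lt (n r : ℕ) {γ : ℝ} (hγ : γ ≠ 1 / 2) :
    mixedMoment (1 / 2) n n (2 * r + 2) < mixedMoment γ n n (2 * r + 2) := by
  induction r generalizing γ with
  | zero =>
    refine mixedMoment_half_lt_of_pos n 0 (fun x => ?_) hγ
    rw [mul_zero, mixedMoment_zero]
    exact mul_pos (risingFactorial_pos (by norm_num) _) (risingFactorial_pos (by norm_num) _)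
  | succ r ih =>
    refine mixedMoment_half_lt_of_pos n (r + 1) (fun x => ?_) hγ
    rcases eq_or_ne x (1 / 2) with rfl | hx
    · exact mixedMoment_half_even_pos n (r + 1)
    · exact (mixedMoment_half_even_pos n (r + 1)).trans (ih hx)

/-- A lower bound `C` for the moments with factor `X ^ m` gives the strict lower bound
`(1 / 2 + m) * C` for those with factor `X ^ (m + 1)`, if it is strict at `γ = 0` and at the
critical points of the latter. -/
lemma lt_mixedMoment_left_succ {m n N : ℕ} {C : ℝ}
    (h : ∀ γ ∈ Set.Icc (0 : ℝ) 1,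
      mixedMoment γ (m + 1) n N = 0 → C < mixedMoment γ m n (N + 1))
    (hle : ∀ γ ∈ Set.Icc (0 : ℝ) 1, C ≤ mixedMoment γ m n (N + 1))
    (h0 : C < mixedMoment 0 m n (N + 1))
    {γ : ℝ} (hγ : γ ∈ Set.Icc (0 : ℝ) 1) :
    (1 / 2 + m) * C < mixedMoment γ (m + 1) n (N + 1) := by
  obtain ⟨x, hx, hmin⟩ := isCompact_Icc.exists_isMinOn ⟨γ, hγ⟩
    (continuous_mixedMoment (m + 1) n (N + 1)).continuousOn
  refine lt_of_lt_of_le ?_ (hmin hγ)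
  show _ < mixedMoment x (m + 1) n (N + 1)
  rw [mixedMoment_left_succ]
  have hm : (0 : ℝ) < 1 / 2 + m := by positivity
  rcases eq_or_lt_of_le hx.1 with rfl | hx0
  · have := mul_lt_mul_of_pos_left h0 hm
    linarith
  rcases eq_or_lt_of_le hx.2 with rfl | hx1
  · have h1 := mul_le_mul_of_nonneg_left (hle 1 hx) hm.le
    have h2 : 0 < (N + 1 : ℝ) * 1 * mixedMoment 1 (m + 1) n N :=
      mul_pos (by positivity) (mixedMoment_one_pos N (m + 1) n)
    linarith
  · have hz := (hmin.isLocalMin (Icc_mem_nhds hx0 hx1)).hasDerivAt_eq_zero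
      (hasDerivAt_mixedMoment_succ x N (m + 1) n)
    have hz' : mixedMoment x (m + 1) n N = 0 :=
      (mul_eq_zero.1 hz).resolve_left (by positivity)
    rw [hz', mul_zero, add_zero]
    exact mul_lt_mul_of_pos_left (h x hx hz') hm

lemma lt_mixedMoment (n r d : ℕ) {γ : ℝ} (hγ : γ ∈ Set.Icc (0 : ℝ) 1) :
    risingFactorial (1 / 2) (n + 1 + d) * risingFactorial (1 / 2) (n + (r + 1)) *
      risingFactorial (1 / 2) (r + 1) < mixedMoment γ (n + 1 + d) n (2 * r + 2) := by
  induction d generalizing γ with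
  | zero =>
    have heven := mixedMoment_half_even n (r + 1)
    have key := lt_mixedMoment_left_succ (m := n) (n := n) (N := 2 * r + 1)
      (C := mixedMoment (1 / 2) n n (2 * r + 2)) (fun x _ hx0 => ?_) (fun x _ => ?_)
      (mixedMoment_half_lt n r (by norm_num)) hγ
    · refine lt_of_eq_of_lt ?_ key
      rw [show 2 * r + 2 = 2 * (r + 1) by ring, heven, add_zero, risingFactorial_succ]
      ring
    · refine mixedMoment_half_lt n r ?_
      rintro rfl
      exact (mixedMoment_half_left_pos n (2 * r + 1)).ne' hx0
    · rcases eq_or_ne x (1 / 2) with rfl | hx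
      · exact le_rfl
      · exact (mixedMoment_half_lt n r hx).le
  | succ d ih =>
    have key := lt_mixedMoment_left_succ (fun x hx _ => ih hx) (fun x hx => (ih hx).le)
      (ih (by simp)) hγ
    refine lt_of_eq_of_lt ?_ key
    rw [← add_assoc (n + 1) d 1, risingFactorial_succ _ (n + 1 + d)]
    ring

lemma Gamma_nat_add_half_eq (k : ℕ) :
    Real.Gamma (k + 1 / 2) = risingFactorial (1 / 2) k * √Real.pi := by
  induction k with
  | zero => simp [risingFactorial_zero, Real.Gamma_one_half_eq, -one_div]
  | succ k ih =>
    rw [show ((k + 1 : ℕ) : ℝ) + 1 / 2 = (k + 1 / 2 : ℝ) + 1 by push_cast; ring,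
      Real.Gamma_add_one (by positivity), ih, risingFactorial_succ]
    ring

lemma integral_pow_gaussianReal (k : ℕ) :
    ∫ x, x ^ (2 * k) ∂(gaussianReal 0 1) = 2 ^ k * risingFactorial (1 / 2) k := by
  rw [integral_gaussianReal_eq_integral_smul one_ne_zero]
  have h1 : ∀ x : ℝ, gaussianPDFReal 0 1 x • x ^ (2 * k) =
      (√(2 * Real.pi))⁻¹ *
        (fun y : ℝ => y ^ ((2 * k : ℕ) : ℝ) * Real.exp (-(1 / 2) * y ^ (2 : ℝ))) |x| := by
    intro x
    simp only [gaussianPDFReal, smul_eq_mul, Real.rpow_natCast, Real.rpow_ofNat, sq_abs,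
      Even.pow_abs (even_two_mul k), NNReal.coe_one, mul_one, sub_zero]
    rw [show -x ^ 2 / 2 = -(1 / 2) * x ^ 2 by ring]
    ring
  simp_rw [h1]
  rw [integral_const_mul, integral_comp_abs
      (f := fun y : ℝ => y ^ ((2 * k : ℕ) : ℝ) * Real.exp (-(1 / 2) * y ^ (2 : ℝ))),
    integral_rpow_mul_exp_neg_mul_rpow (by norm_num) (by
      have : (0 : ℝ) ≤ ((2 * k : ℕ) : ℝ) := by positivity
      linarith) (by norm_num)]
  have h2 : (((2 * k : ℕ) : ℝ) + 1) / 2 = k + 1 / 2 := by push_cast; ring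
  rw [neg_div, h2, Gamma_nat_add_half_eq, one_div (2 : ℝ), Real.inv_rpow (by norm_num),
    Real.rpow_neg (by norm_num), inv_inv, Real.rpow_add (by norm_num), Real.rpow_natCast,
    ← one_div (2 : ℝ), ← Real.sqrt_eq_rpow, Real.sqrt_mul (by norm_num)]
  have : √Real.pi ≠ 0 := by positivity
  field_simp

lemma integrable_pow_gaussianReal (k : ℕ) :
    Integrable (fun x : ℝ => x ^ k) (gaussianReal 0 1) := by
  have := (memLp_id_gaussianReal (μ := 0) (v := 1) k).integrable_norm_pow'
  refine (integrable_norm_iff (by fun_prop)).1 ?_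
  simpa using this

section

variable {Ω : Type*} [MeasurableSpace Ω] {P : Measure Ω} {U V : Ω → ℝ}

lemma aemeasurable_of_map_gaussianReal (hU : Measure.map U P = gaussianReal 0 1) :
    AEMeasurable U P :=
  aemeasurable_of_map_neZero (by rw [hU]; infer_instance)

lemma integrable_pow_of_map_gaussianReal (hU : Measure.map U P = gaussianReal 0 1) (k : ℕ) :
    Integrable (fun ω => U ω ^ k) P := by
  have h := integrable_pow_gaussianReal k
  rw [← hU] at h
  exact h.comp_aemeasurable (aemeasurable_of_map_gaussianReal hU)

lemma integral_pow_of_map_gaussianReal (hU : Measure.map U P = gaussianReal 0 1) (k : ℕ) :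
    ∫ ω, U ω ^ (2 * k) ∂P = 2 ^ k * risingFactorial (1 / 2) k := by
  rw [← integral_pow_gaussianReal, ← hU,
    integral_map (aemeasurable_of_map_gaussianReal hU) (by fun_prop)]

lemma integrable_and_integral_eq_mixedMoment
    (hU : Measure.map U P = gaussianReal 0 1) (hV : Measure.map V P = gaussianReal 0 1)
    (hindep : IndepFun U V P) (γ : ℝ) (N : ℕ) : ∀ i j : ℕ,
    Integrable (fun ω => U ω ^ (2 * i) * V ω ^ (2 * j) *
      (γ * U ω ^ 2 - (1 - γ) * V ω ^ 2) ^ N) P ∧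
    ∫ ω, U ω ^ (2 * i) * V ω ^ (2 * j) * (γ * U ω ^ 2 - (1 - γ) * V ω ^ 2) ^ N ∂P =
      2 ^ (i + j + N) * mixedMoment γ i j N := by
  induction N with
  | zero =>
    intro i j
    have hi : IndepFun (fun ω => U ω ^ (2 * i)) (fun ω => V ω ^ (2 * j)) P :=
      hindep.comp (φ := fun x => x ^ (2 * i)) (ψ := fun x => x ^ (2 * j))
        (by fun_prop) (by fun_prop)
    have hUi := integrable_pow_of_map_gaussianReal hU (2 * i)
    have hVj := integrable_pow_of_map_gaussianReal hV (2 * j)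
    simp only [pow_zero, mul_one]
    refine ⟨hi.integrable_mul hUi hVj, ?_⟩
    rw [hi.integral_fun_mul_eq_mul_integral hUi.aestronglyMeasurable hVj.aestronglyMeasurable,
      integral_pow_of_map_gaussianReal hU, integral_pow_of_map_gaussianReal hV,
      mixedMoment_zero]
    ring
  | succ N ih =>
    intro i j
    obtain ⟨hint1, heq1⟩ := ih (i + 1) j
    obtain ⟨hint2, heq2⟩ := ih i (j + 1)
    have hsplit : ∀ ω, U ω ^ (2 * i) * V ω ^ (2 * j) *
        (γ * U ω ^ 2 - (1 - γ) * V ω ^ 2) ^ (N + 1) =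
        γ * (U ω ^ (2 * (i + 1)) * V ω ^ (2 * j) * (γ * U ω ^ 2 - (1 - γ) * V ω ^ 2) ^ N) -
        (1 - γ) * (U ω ^ (2 * i) * V ω ^ (2 * (j + 1)) *
          (γ * U ω ^ 2 - (1 - γ) * V ω ^ 2) ^ N) := by
      intro ω
      ring
    simp_rw [hsplit]
    refine ⟨(hint1.const_mul _).sub (hint2.const_mul _), ?_⟩
    rw [integral_sub (hint1.const_mul _) (hint2.const_mul _), integral_const_mul,
      integral_const_mul, heq1, heq2, mixedMoment_succ]
    ring

end

/-- For independent standard Gaussians `U, V`, nonnegative integers `m > n`, a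
positive integer `r`, and every `γ ∈ (0,1)`:
`E[U^{2m} V^{2n} (γU² - (1-γ)V²)^{2r}] > 2^{m+n+2r} (1/2)_m (1/2)_{n+r} (1/2)_r`. -/
theorem gaussian_asymmetric_moment_strict_bound
    {Ω : Type*} [MeasurableSpace Ω] (P : Measure Ω) [IsProbabilityMeasure P]
    (U V : Ω → ℝ)
    (hU : Measure.map U P = gaussianReal 0 1)
    (hV : Measure.map V P = gaussianReal 0 1)
    (hindep : IndepFun U V P)
    (m n r : ℕ) (hmn : m > n) (hr : 0 < r)
    (γ : ℝ) (h0 : 0 < γ) (h1 : γ < 1) :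
    (∫ ω, (U ω) ^ (2 * m) * (V ω) ^ (2 * n) *
        (γ * (U ω) ^ 2 - (1 - γ) * (V ω) ^ 2) ^ (2 * r) ∂P)
      > 2 ^ (m + n + 2 * r) * risingFactorial (1 / 2) m *
          risingFactorial (1 / 2) (n + r) * risingFactorial (1 / 2) r := by
  obtain ⟨d, rfl⟩ := Nat.exists_eq_add_of_lt hmn
  obtain ⟨r, rfl⟩ := Nat.exists_eq_succ_of_ne_zero hr.ne'
  rw [(integrable_and_integral_eq_mixedMoment hU hV hindep γ _ _ _).2, gt_iff_lt, mul_assoc,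
    mul_assoc, ← mul_assoc (risingFactorial _ _)]
  refine mul_lt_mul_of_pos_left ?_ (by positivity)
  have h := lt_mixedMoment n r d ⟨h0.le, h1.le⟩
  rwa [add_right_comm n 1 d] at h
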